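/- arXiv:2604.10850 — 5 statements merged into one kernel-verified Lean document; each statement's English description precedes it below -/
import Mathlib

section
/- Let S ⊆ ℤ × ℤ be nonempty and bounded below componentwise. Define the lexicographic vector z^{L1} by z^{L1}.1 = min{ z.1 : z ∈ S } and z^{L1}.2 = min{ z.2 : z ∈ S and z.1 = z^{L1}.1 }, and define z^{L2} symmetrically with the roles of the coordinates exchanged. Then every nondominated point z of S satisfies z^{L2}.2 ≤ z.2 ≤ z^{L1}.2, and the number of nondominated points of S is at most z^{L1}.2 − z^{L2}.2 + 1. -/
/-- `Dominates z z'` means `z` dominates `z'` in the componentwise order on `ℤ × ℤ`. -/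
def Dominates (z z' : ℤ × ℤ) : Prop :=
  z.1 ≤ z'.1 ∧ z.2 ≤ z'.2 ∧ z ≠ z'

/-- The set of nondominated (Pareto optimal) points of `S ⊆ ℤ × ℤ`. -/
def ParetoFront (S : Set (ℤ × ℤ)) : Set (ℤ × ℤ) :=
  {z ∈ S | ¬∃ z' ∈ S, Dominates z' z}

/-- Distinct nondominated points have distinct second coordinates. -/
theorem injOn_snd_paretoFront (S : Set (ℤ × ℤ)) : Set.InjOn Prod.snd (ParetoFront S) := by
  rintro z ⟨hzS, hz⟩ w ⟨hwS, hw⟩ h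
  by_contra hzw
  rcases le_total z.1 w.1 with h1 | h1
  · exact hw ⟨z, hzS, h1, h.le, hzw⟩
  · exact hz ⟨w, hwS, h1, h.ge, Ne.symm hzw⟩

/-- A nondominated point lies weakly below, in the second coordinate, every point of `S`
whose first coordinate is at most its own. -/
theorem snd_le_of_mem_paretoFront {S : Set (ℤ × ℤ)} {z w : ℤ × ℤ} (hz : z ∈ ParetoFront S)
    (hw : w ∈ S) (h : w.1 ≤ z.1) : z.2 ≤ w.2 := by
  by_contra! hlt
  exact hz.2 ⟨w, hw, h, hlt.le, fun e => hlt.ne (congrArg Prod.snd e)⟩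

/-- Every nondominated point has its second coordinate between the second
coordinates of the two lexicographic vectors, and the number of nondominated
points is at most `zL1.2 - zL2.2 + 1`. -/
theorem paretoFront_between_lex_and_card_bound
    (S : Set (ℤ × ℤ)) (hne : S.Nonempty)
    (m₁ m₂ : ℤ) (hbd : ∀ z ∈ S, m₁ ≤ z.1 ∧ m₂ ≤ z.2)
    (zL1 zL2 : ℤ × ℤ)
    (hL1₁ : zL1.1 = sInf {t : ℤ | ∃ z ∈ S, z.1 = t})
    (hL1₂ : zL1.2 = sInf {t : ℤ | ∃ z ∈ S, z.1 = zL1.1 ∧ z.2 = t})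
    (hL2₂ : zL2.2 = sInf {t : ℤ | ∃ z ∈ S, z.2 = t})
    (hL2₁ : zL2.1 = sInf {t : ℤ | ∃ z ∈ S, z.2 = zL2.2 ∧ z.1 = t}) :
    (∀ z ∈ ParetoFront S, zL2.2 ≤ z.2 ∧ z.2 ≤ zL1.2) ∧
    ((ParetoFront S).ncard : ℤ) ≤ zL1.2 - zL2.2 + 1 := by
  have hbdd₁ : BddBelow {t : ℤ | ∃ z ∈ S, z.1 = t} :=
    ⟨m₁, by rintro t ⟨z, hz, rfl⟩; exact (hbd z hz).1⟩
  have hbdd₂ : BddBelow {t : ℤ | ∃ z ∈ S, z.2 = t} :=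
    ⟨m₂, by rintro t ⟨z, hz, rfl⟩; exact (hbd z hz).2⟩
  have hbddL : BddBelow {t : ℤ | ∃ z ∈ S, z.1 = zL1.1 ∧ z.2 = t} :=
    ⟨m₂, by rintro t ⟨z, hz, -, rfl⟩; exact (hbd z hz).2⟩
  obtain ⟨a, haS⟩ := hne
  have hne₁ : {t : ℤ | ∃ z ∈ S, z.1 = t}.Nonempty := ⟨a.1, a, haS, rfl⟩
  obtain ⟨b, hbS, hb⟩ := Int.csInf_mem hne₁ hbdd₁
  have hneL : {t : ℤ | ∃ z ∈ S, z.1 = zL1.1 ∧ z.2 = t}.Nonempty :=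
    ⟨b.2, b, hbS, hb.trans hL1₁.symm, rfl⟩
  obtain ⟨w, hwS, hw1, hw2⟩ := Int.csInf_mem hneL hbddL
  have hmin₁ : ∀ z ∈ S, zL1.1 ≤ z.1 := fun z hz =>
    hL1₁.trans_le (csInf_le hbdd₁ ⟨z, hz, rfl⟩)
  have hmin₂ : ∀ z ∈ S, zL2.2 ≤ z.2 := fun z hz =>
    hL2₂.trans_le (csInf_le hbdd₂ ⟨z, hz, rfl⟩)
  have hw : w.2 = zL1.2 := hw2.trans hL1₂.symm
  have hbetween : ∀ z ∈ ParetoFront S, zL2.2 ≤ z.2 ∧ z.2 ≤ zL1.2 := fun z hz =>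
    ⟨hmin₂ z hz.1, hw ▸ snd_le_of_mem_paretoFront hz hwS (hw1.trans_le (hmin₁ z hz.1))⟩
  refine ⟨hbetween, ?_⟩
  have hcard : (ParetoFront S).ncard ≤ (Finset.Icc zL2.2 zL1.2 : Set ℤ).ncard :=
    Set.ncard_le_ncard_of_injOn Prod.snd
      (fun z hz => Finset.mem_coe.2 (Finset.mem_Icc.2 (hbetween z hz)))
      (injOn_snd_paretoFront S) (Finset.finite_toSet _)
  rw [Set.ncard_coe_finset, Int.card_Icc] at hcard
  have hle := hmin₂ w hwS
  omega
end

section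
/- Let S ⊆ ℤ × ℤ be nonempty, let m, M ∈ ℤ with m < M and m ≤ z.1 ≤ M for every z ∈ S, and let w be a real number with 0 < w < 1/(M − m). If z* ∈ S satisfies w·z*.1 + z*.2 ≤ w·z.1 + z.2 for every z ∈ S, then z*.2 = min{ z.2 : z ∈ S } and z*.1 = min{ z.1 : z ∈ S and z.2 = z*.2 }; that is, z* is the lexicographic minimum of S with priority on the second coordinate. This justifies the weight choice w(ζ)_{i₁} = (γ − ζ)/(ẑ_{i₁} − z̄_{i₁}), w(ζ)_{i₂} = 1 of the Custom Weighted-sum Scalarization. -/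
/-- With a sufficiently small positive weight `w < 1/(M − m)` on the first coordinate,
a minimizer of `w·z.1 + z.2` over `S` is the lexicographic minimum of `S` with
priority on the second coordinate: its second coordinate is the minimum of the
second coordinates over `S`, and its first coordinate is the minimum of the first
coordinates among those attaining it. -/
theorem cws_small_weight_gives_lex_min
    (S : Set (ℤ × ℤ)) (hne : S.Nonempty)
    (m M : ℤ) (hmM : m < M) (hbd : ∀ z ∈ S, m ≤ z.1 ∧ z.1 ≤ M)
    (w : ℝ) (hw : 0 < w) (hw' : w < 1 / ((M : ℝ) - (m : ℝ)))
    (zstar : ℤ × ℤ) (hmem : zstar ∈ S)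
    (hmin : ∀ z ∈ S, w * (zstar.1 : ℝ) + (zstar.2 : ℝ) ≤ w * (z.1 : ℝ) + (z.2 : ℝ)) :
    IsLeast {t : ℤ | ∃ z ∈ S, z.2 = t} zstar.2 ∧
    IsLeast {t : ℤ | ∃ z ∈ S, z.2 = zstar.2 ∧ z.1 = t} zstar.1 := by
  have hpos : (0 : ℝ) < (M : ℝ) - m := sub_pos.mpr (by exact_mod_cast hmM)
  rw [lt_div_iff₀ hpos] at hw'
  refine ⟨⟨⟨zstar, hmem, rfl⟩, ?_⟩, ⟨⟨zstar, hmem, rfl, rfl⟩, ?_⟩⟩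
  · rintro _ ⟨z, hz, rfl⟩
    by_contra! hlt
    have hgap : (z.2 : ℝ) + 1 ≤ zstar.2 := by exact_mod_cast hlt
    have hupper : (z.1 : ℝ) ≤ M := by exact_mod_cast (hbd z hz).2
    have hlower : (m : ℝ) ≤ zstar.1 := by exact_mod_cast (hbd zstar hmem).1
    have hrange : w * ((z.1 : ℝ) - zstar.1) ≤ w * ((M : ℝ) - m) :=
      mul_le_mul_of_nonneg_left (sub_le_sub hupper hlower) hw.le
    linarith [hmin z hz]
  · rintro _ ⟨z, hz, heq, rfl⟩
    have hle := hmin z hz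
    rw [heq] at hle
    exact_mod_cast le_of_mul_le_mul_left (le_of_add_le_add_right hle) hw
end

section
/- Let S ⊆ ℤ × ℤ be nonempty and bounded below componentwise, and let ε ∈ ℤ be such that S_ε := { z ∈ S : z.2 ≤ ε } is nonempty. Define a := min{ z.1 : z ∈ S_ε } (the optimal value of subproblem Sub1) and b := min{ z.2 : z ∈ S and z.1 ≤ a } (the optimal value of subproblem Sub2). Then the point (a, b) belongs to S and is a nondominated point of S. That is, each iteration of the lexicographic ε-constraint method produces a nondominated point without any need to filter out dominated points. -/
/-- Each iteration of the lexicographic ε-constraint method (solving Sub1 and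
then Sub2) produces a point of `S` which is nondominated. -/
theorem lex_eps_constraint_iteration_nondominated
    (S : Set (ℤ × ℤ)) (hne : S.Nonempty)
    (m₁ m₂ : ℤ) (hbd : ∀ z ∈ S, m₁ ≤ z.1 ∧ m₂ ≤ z.2)
    (ε : ℤ) (hε : {z ∈ S | z.2 ≤ ε}.Nonempty)
    (a b : ℤ)
    (ha : a = sInf {t : ℤ | ∃ z ∈ S, z.2 ≤ ε ∧ z.1 = t})
    (hb : b = sInf {t : ℤ | ∃ z ∈ S, z.1 ≤ a ∧ z.2 = t}) :
    (a, b) ∈ ParetoFront S := by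
  obtain ⟨z₀, hz₀, hz₀ε⟩ := hε
  have bdd₁ : BddBelow {t : ℤ | ∃ z ∈ S, z.2 ≤ ε ∧ z.1 = t} := by
    refine ⟨m₁, ?_⟩
    rintro _ ⟨z, hz, -, rfl⟩
    exact (hbd z hz).1
  have bdd₂ : BddBelow {t : ℤ | ∃ z ∈ S, z.1 ≤ a ∧ z.2 = t} := by
    refine ⟨m₂, ?_⟩
    rintro _ ⟨z, hz, -, rfl⟩
    exact (hbd z hz).2
  have a_le : ∀ z ∈ S, z.2 ≤ ε → a ≤ z.1 := fun z hz hzε => by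
    rw [ha]; exact csInf_le bdd₁ ⟨z, hz, hzε, rfl⟩
  have b_le : ∀ z ∈ S, z.1 ≤ a → b ≤ z.2 := fun z hz hza => by
    rw [hb]; exact csInf_le bdd₂ ⟨z, hz, hza, rfl⟩
  have nonempty₁ : {t : ℤ | ∃ z ∈ S, z.2 ≤ ε ∧ z.1 = t}.Nonempty :=
    ⟨z₀.1, z₀, hz₀, hz₀ε, rfl⟩
  obtain ⟨p, hp, hpε, hpa⟩ := Int.csInf_mem nonempty₁ bdd₁
  rw [← ha] at hpa
  have nonempty₂ : {t : ℤ | ∃ z ∈ S, z.1 ≤ a ∧ z.2 = t}.Nonempty :=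
    ⟨p.2, p, hp, hpa.le, rfl⟩
  obtain ⟨q, hq, hqa, hqb⟩ := Int.csInf_mem nonempty₂ bdd₂
  rw [← hb] at hqb
  have hbε : b ≤ ε := (b_le p hp hpa.le).trans hpε
  have hqa' : q.1 = a := le_antisymm hqa (a_le q hq (hqb.trans_le hbε))
  refine ⟨?_, ?_⟩
  · rwa [← hqa', ← hqb]
  · rintro ⟨z, hz, h₁, h₂, hz_ne⟩
    exact hz_ne (Prod.ext (le_antisymm h₁ (a_le z hz (h₂.trans hbε)))
      (le_antisymm h₂ (b_le z hz h₁)))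
end

section
/- Let S ⊆ ℤ × ℤ be nonempty and bounded below componentwise, and let z be any nondominated point of S. Then min{ z'.1 : z' ∈ S and z'.2 ≤ z.2 } = z.1 and min{ z'.2 : z' ∈ S and z'.1 ≤ z.1 } = z.2. Consequently, taking ε := z.2, the iteration of the lexicographic ε-constraint method with parameter ε produces exactly the point z; hence the method generates every nondominated point of S (the entire Pareto front). -/
/-- For every nondominated point `z` of `S`, the lexicographic ε-constraint
iteration with `ε = z.2` recovers exactly `z`: the optimal value of Sub1 is `z.1`
and the optimal value of Sub2 is `z.2`. Hence the method generates the entire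
Pareto front. -/
theorem lex_eps_constraint_reaches_every_nondominated
    (S : Set (ℤ × ℤ)) (hne : S.Nonempty)
    (m₁ m₂ : ℤ) (hbd : ∀ z ∈ S, m₁ ≤ z.1 ∧ m₂ ≤ z.2)
    (z : ℤ × ℤ) (hz : z ∈ ParetoFront S) :
    IsLeast {t : ℤ | ∃ z' ∈ S, z'.2 ≤ z.2 ∧ z'.1 = t} z.1 ∧
    IsLeast {t : ℤ | ∃ z' ∈ S, z'.1 ≤ z.1 ∧ z'.2 = t} z.2 := by
  obtain ⟨hzS, hnd⟩ := hz
  refine ⟨⟨⟨z, hzS, le_rfl, rfl⟩, ?_⟩, ⟨⟨z, hzS, le_rfl, rfl⟩, ?_⟩⟩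
  · rintro _ ⟨z', hz', hle, rfl⟩
    by_contra! hlt
    exact hnd ⟨z', hz', hlt.le, hle, fun h => hlt.ne (congrArg Prod.fst h)⟩
  · rintro _ ⟨z', hz', hle, rfl⟩
    by_contra! hlt
    exact hnd ⟨z', hz', hle, hlt.le, fun h => hlt.ne (congrArg Prod.snd h)⟩
end

section
/- Let S ⊆ ℤ × ℤ, let I₁, I₂ ∈ ℤ satisfy I₁ ≤ z.1 and I₂ ≤ z.2 for every z ∈ S (ideal-point lower bounds), and let β₁, β₂, ρ be positive reals and w a real with 0 < w < 1. Define the augmented weighted Tchebycheff objective G(z) := max( β₁·w·(z.1 − I₁), β₂·(1 − w)·(z.2 − I₂) ) + ρ·( β₁·(z.1 − I₁) + β₂·(z.2 − I₂) ). If z* ∈ S satisfies G(z*) ≤ G(z) for every z ∈ S, then z* is a nondominated point of S. -/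
/-- A minimizer of the augmented weighted Tchebycheff objective (with positive
normalization constants, weight `w ∈ (0,1)`, augmentation parameter `ρ > 0`, and
ideal-point lower bounds `I₁, I₂`) is a nondominated point of `S`. -/
theorem augmented_weighted_tchebycheff_minimizer_nondominated
    (S : Set (ℤ × ℤ)) (I₁ I₂ : ℤ)
    (hI : ∀ z ∈ S, I₁ ≤ z.1 ∧ I₂ ≤ z.2)
    (β₁ β₂ ρ : ℝ) (hβ₁ : 0 < β₁) (hβ₂ : 0 < β₂) (hρ : 0 < ρ)
    (w : ℝ) (hw : 0 < w) (hw' : w < 1)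
    (G : ℤ × ℤ → ℝ)
    (hG : ∀ z : ℤ × ℤ, G z =
      max (β₁ * w * ((z.1 : ℝ) - (I₁ : ℝ))) (β₂ * (1 - w) * ((z.2 : ℝ) - (I₂ : ℝ))) +
        ρ * (β₁ * ((z.1 : ℝ) - (I₁ : ℝ)) + β₂ * ((z.2 : ℝ) - (I₂ : ℝ))))
    (zstar : ℤ × ℤ) (hmem : zstar ∈ S)
    (hmin : ∀ z ∈ S, G zstar ≤ G z) :
    zstar ∈ ParetoFront S := by
  refine ⟨hmem, ?_⟩
  rintro ⟨z, hz, h₁, h₂, hne⟩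
  have hlt : (z.1 : ℝ) < zstar.1 ∨ (z.2 : ℝ) < zstar.2 := by
    by_contra! h
    exact hne (Prod.ext (le_antisymm h₁ (by exact_mod_cast h.1))
      (le_antisymm h₂ (by exact_mod_cast h.2)))
  have h₁' : (z.1 : ℝ) ≤ zstar.1 := by exact_mod_cast h₁
  have h₂' : (z.2 : ℝ) ≤ zstar.2 := by exact_mod_cast h₂
  have hmax : max (β₁ * w * ((z.1 : ℝ) - I₁)) (β₂ * (1 - w) * ((z.2 : ℝ) - I₂)) ≤
      max (β₁ * w * ((zstar.1 : ℝ) - I₁)) (β₂ * (1 - w) * ((zstar.2 : ℝ) - I₂)) := by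
    have hw₂ : 0 ≤ 1 - w := by linarith
    gcongr
  have hsum : β₁ * ((z.1 : ℝ) - I₁) + β₂ * ((z.2 : ℝ) - I₂) <
      β₁ * ((zstar.1 : ℝ) - I₁) + β₂ * ((zstar.2 : ℝ) - I₂) := by
    rcases hlt with h | h
    · exact add_lt_add_of_lt_of_le (by gcongr) (by gcongr)
    · exact add_lt_add_of_le_of_lt (by gcongr) (by gcongr)
  have hG_le := hmin z hz
  rw [hG, hG] at hG_le
  exact absurd hG_le (not_le.mpr (add_lt_add_of_le_of_lt hmax (mul_lt_mul_of_pos_left hsum hρ)))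
end
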